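/- arXiv:1606.08338 — 2 statements merged into one kernel-verified Lean document; each statement's English description precedes it below -/
import Mathlib

section
/- Let A be a Banach algebra and φ ∈ Δ(A). If A is approximately biprojective, then A is approximately left φ-biprojective. -/
open Filter Topology

universe u

/-! ## Nets indexed by directed sets -/

/-- A (nonempty) directed index type, used to index nets. -/
structure DirSys : Type (u + 1) where
  ι : Type u
  [pre : Preorder ι]
  [dir : IsDirected ι (· ≤ ·)]
  [ne : Nonempty ι]

attribute [instance] DirSys.pre DirSys.dir DirSys.ne

section Core

variable (A : Type u) [NonUnitalNormedRing A] [NormedSpace ℂ A]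
  [IsScalarTower ℂ A A] [SMulCommClass ℂ A A]

/-- A realization of the projective tensor product `A ⊗̂ A` of a Banach algebra `A` with
itself, together with its canonical Banach `A`-bimodule structure and the product
(diagonal) map `π_A`.  The field `universal` is the universal property of the projective
tensor norm, which pins the object down uniquely up to isometric isomorphism. -/
structure ProjTensorSq (X : Type u) [NormedAddCommGroup X] [NormedSpace ℂ X]
    [CompleteSpace X] : Type (u + 1) where
  /-- the canonical bilinear map `(a, b) ↦ a ⊗ b` -/
  tmul : A →L[ℂ] A →L[ℂ] X
  /-- the projective norm is a cross norm -/
  norm_tmul : ∀ a b : A, ‖tmul a b‖ = ‖a‖ * ‖b‖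
  /-- elementary tensors span a dense subspace -/
  dense_span : Dense (Submodule.span ℂ (Set.range fun p : A × A => tmul p.1 p.2) : Set X)
  /-- the universal property of the projective tensor product -/
  universal : ∀ (Y : Type u) [NormedAddCommGroup Y] [NormedSpace ℂ Y] [CompleteSpace Y]
      (f : A →L[ℂ] A →L[ℂ] Y), ∃ g : X →L[ℂ] Y, ‖g‖ ≤ ‖f‖ ∧ ∀ a b : A, g (tmul a b) = f a b
  /-- the left module action `a · (b ⊗ c) = (a * b) ⊗ c` -/
  lsmul : A →L[ℂ] X →L[ℂ] X
  lsmul_tmul : ∀ a b c : A, lsmul a (tmul b c) = tmul (a * b) c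
  /-- the right module action `(b ⊗ c) · a = b ⊗ (c * a)` -/
  rsmul : A →L[ℂ] X →L[ℂ] X
  rsmul_tmul : ∀ a b c : A, rsmul a (tmul b c) = tmul b (c * a)
  /-- the product map `π_A`, determined by `π_A (a ⊗ b) = a * b` -/
  projL : X →L[ℂ] A
  projL_tmul : ∀ a b : A, projL (tmul a b) = a * b

variable {A}

/-- `A` is approximately left `φ`-biprojective:  there is a net `(ρ_α)` of bounded linear
maps `A → A ⊗̂ A` with `a·ρ_α(x) - ρ_α(ax) → 0`, `ρ_α(xa) - φ(a)ρ_α(x) → 0` and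
`φ(π_A(ρ_α(x))) → φ(x)` for all `a x : A`. -/
def ApproxLeftBiprojective (φ : WeakDual.characterSpace ℂ A) : Prop :=
  ∀ (X : Type u) [NormedAddCommGroup X] [NormedSpace ℂ X] [CompleteSpace X]
    (P : ProjTensorSq A X),
    ∃ (D : DirSys.{u}) (ρ : D.ι → (A →L[ℂ] X)),
      (∀ a x : A, Tendsto (fun i => P.lsmul a (ρ i x) - ρ i (a * x)) atTop (𝓝 0)) ∧
      (∀ a x : A, Tendsto (fun i => ρ i (x * a) - φ a • ρ i x) atTop (𝓝 0)) ∧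
      (∀ x : A, Tendsto (fun i => φ (P.projL (ρ i x))) atTop (𝓝 (φ x)))

/-- `A` is approximately left character biprojective if it is approximately left
`φ`-biprojective for every character `φ` of `A`. -/
def ApproxLeftCharBiprojective : Prop :=
  ∀ φ : WeakDual.characterSpace ℂ A, ApproxLeftBiprojective φ

/-- `A` is approximately left `φ`-amenable: there is a (not necessarily bounded) net
`(a_α)` in `A` with `‖a * a_α - φ(a) a_α‖ → 0` for every `a` and `φ(a_α) → 1`. -/
def ApproxLeftAmenable (φ : WeakDual.characterSpace ℂ A) : Prop :=
  ∃ (D : DirSys.{u}) (v : D.ι → A),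
    (∀ a : A, Tendsto (fun i => a * v i - φ a • v i) atTop (𝓝 0)) ∧
    Tendsto (fun i => φ (v i)) atTop (𝓝 1)

/-- `A` is approximately biprojective (Zhang): there is a net `(ρ_α)` of bounded
`A`-bimodule morphisms `A → A ⊗̂ A` with `π_A(ρ_α(a)) → a` for every `a`. -/
def ApproxBiprojective : Prop :=
  ∀ (X : Type u) [NormedAddCommGroup X] [NormedSpace ℂ X] [CompleteSpace X]
    (P : ProjTensorSq A X),
    ∃ (D : DirSys.{u}) (ρ : D.ι → (A →L[ℂ] X)),
      (∀ i, ∀ a b : A, ρ i (a * b) = P.lsmul a (ρ i b)) ∧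
      (∀ i, ∀ a b : A, ρ i (a * b) = P.rsmul b (ρ i a)) ∧
      (∀ a : A, Tendsto (fun i => P.projL (ρ i a)) atTop (𝓝 a))

/-- `A` is pseudo-amenable: there is a (not necessarily bounded) net `(m_α)` in `A ⊗̂ A`
with `a·m_α - m_α·a → 0` and `π_A(m_α) a → a` for every `a`. -/
def PseudoAmenable : Prop :=
  ∀ (X : Type u) [NormedAddCommGroup X] [NormedSpace ℂ X] [CompleteSpace X]
    (P : ProjTensorSq A X),
    ∃ (D : DirSys.{u}) (m : D.ι → X),
      (∀ a : A, Tendsto (fun i => P.lsmul a (m i) - P.rsmul a (m i)) atTop (𝓝 0)) ∧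
      (∀ a : A, Tendsto (fun i => P.projL (m i) * a - a) atTop (𝓝 0))

end Core

namespace ProjTensorSq

variable {A : Type u} [NonUnitalNormedRing A] [NormedSpace ℂ A]
  {X : Type u} [NormedAddCommGroup X] [NormedSpace ℂ X] [CompleteSpace X]

/-- Bounded linear maps that agree on elementary tensors are equal. -/
theorem clm_ext (P : ProjTensorSq A X) {Y : Type*} [NormedAddCommGroup Y] [NormedSpace ℂ Y]
    {f g : X →L[ℂ] Y} (h : ∀ a b : A, f (P.tmul a b) = g (P.tmul a b)) : f = g := by
  refine ContinuousLinearMap.ext_on P.dense_span ?_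
  rintro _ ⟨p, rfl⟩
  exact h p.1 p.2

/-- The slice map `id ⊗ φ : A ⊗̂ A → A`, together with its compatibility with the module
actions and with the product map. -/
theorem exists_slice [IsScalarTower ℂ A A] [SMulCommClass ℂ A A] [CompleteSpace A]
    (P : ProjTensorSq A X) (φ : WeakDual.characterSpace ℂ A) :
    ∃ S : X →L[ℂ] A, (∀ a t, S (P.lsmul a t) = a * S t) ∧
      (∀ a t, S (P.rsmul a t) = φ a • S t) ∧ (∀ t, φ (S t) = φ (P.projL t)) := by
  let ψ : A →L[ℂ] ℂ := WeakDual.CharacterSpace.toCLM φ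
  obtain ⟨S, -, hS⟩ := P.universal A
    (ContinuousLinearMap.smulRightL ℂ A A ψ)
  have hS' : ∀ a b : A, S (P.tmul a b) = φ b • a := hS
  refine ⟨S, fun a t => ?_, fun a t => ?_, fun t => ?_⟩
  · have h : S ∘L P.lsmul a = ContinuousLinearMap.mul ℂ A a ∘L S :=
      P.clm_ext fun b c => by simp [P.lsmul_tmul, hS']
    exact DFunLike.congr_fun h t
  · have h : S ∘L P.rsmul a = φ a • S :=
      P.clm_ext fun b c => by simp [P.rsmul_tmul, hS', smul_smul, mul_comm]
    exact DFunLike.congr_fun h t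
  · have h : ψ ∘L S = ψ ∘L P.projL :=
      P.clm_ext fun b c => by
        change φ (S (P.tmul b c)) = φ (P.projL (P.tmul b c))
        simp [P.projL_tmul, hS', mul_comm]
    exact DFunLike.congr_fun h t

end ProjTensorSq

/-- Proposition 2.2.  Let `A` be a Banach algebra and `φ ∈ Δ(A)`.
If `A` is approximately biprojective, then `A` is approximately left `φ`-biprojective. -/
theorem approxBiprojective_implies_approxLeftBiprojective
    {A : Type u} [NonUnitalNormedRing A] [NormedSpace ℂ A]
    [IsScalarTower ℂ A A] [SMulCommClass ℂ A A] [CompleteSpace A]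
    (φ : WeakDual.characterSpace ℂ A)
    (hbiproj : ApproxBiprojective (A := A)) :
    ApproxLeftBiprojective φ := by
  intro X _ _ _ P
  obtain ⟨D, ρ, hl, hr, hπ⟩ := hbiproj X P
  obtain ⟨S, hSl, hSr, hSφ⟩ := P.exists_slice φ
  obtain ⟨e, he⟩ : ∃ e : A, φ e = 1 := by
    obtain ⟨b, hb⟩ : ∃ b : A, φ b ≠ 0 := by
      by_contra! h
      exact φ.2.1 (ContinuousLinearMap.ext h)
    exact ⟨(φ b)⁻¹ • b, by simp [hb]⟩
  refine ⟨D, fun i => P.tmul.flip e ∘L S ∘L ρ i, fun a x => ?_, fun a x => ?_, fun x => ?_⟩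
  · simp [P.lsmul_tmul, hl, hSl]
  · simp [hr, hSr]
  · simpa [P.projL_tmul, he, hSφ, Function.comp_def] using
      ((map_continuous φ).tendsto x).comp (hπ x)
end

section
/- Let A and B be Banach algebras, φ ∈ Δ(A) and ψ ∈ Δ(B). Suppose A is unital and B has an idempotent x₀ with ψ(x₀) = 1. If the projective tensor product A⊗̂B is approximately left (φ⊗ψ)-biprojective, then A is approximately left φ-biprojective. -/
open Filter Topology

universe u

section ProjTensorAlg

variable (A B : Type u) [NonUnitalNormedRing A] [NormedSpace ℂ A]
  [IsScalarTower ℂ A A] [SMulCommClass ℂ A A]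
  [NonUnitalNormedRing B] [NormedSpace ℂ B]
  [IsScalarTower ℂ B B] [SMulCommClass ℂ B B]

/-- A realization of the projective tensor product `A ⊗̂ B` of two Banach algebras as a
Banach algebra, with multiplication determined by `(a ⊗ b)(c ⊗ d) = (ac) ⊗ (bd)`. -/
structure ProjTensorAlg (C : Type u) [NonUnitalNormedRing C] [NormedSpace ℂ C]
    [IsScalarTower ℂ C C] [SMulCommClass ℂ C C] [CompleteSpace C] : Type (u + 1) where
  /-- the canonical bilinear map `(a, b) ↦ a ⊗ b` -/
  tmul : A →L[ℂ] B →L[ℂ] C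
  /-- the projective norm is a cross norm -/
  norm_tmul : ∀ (a : A) (b : B), ‖tmul a b‖ = ‖a‖ * ‖b‖
  /-- elementary tensors span a dense subspace -/
  dense_span : Dense (Submodule.span ℂ (Set.range fun p : A × B => tmul p.1 p.2) : Set C)
  /-- the universal property of the projective tensor product -/
  universal : ∀ (Y : Type u) [NormedAddCommGroup Y] [NormedSpace ℂ Y] [CompleteSpace Y]
      (f : A →L[ℂ] B →L[ℂ] Y), ∃ g : C →L[ℂ] Y, ‖g‖ ≤ ‖f‖ ∧ ∀ (a : A) (b : B),
        g (tmul a b) = f a b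
  /-- the multiplication of `C` on elementary tensors -/
  tmul_mul : ∀ (a c : A) (b d : B), tmul a b * tmul c d = tmul (a * c) (b * d)

end ProjTensorAlg

section BilinearEvaluation

set_option maxSynthPendingDepth 4

/-- Evaluation of bounded bilinear forms at a pair of vectors. -/
noncomputable def bilinEval (E : Type u) [NormedAddCommGroup E] [NormedSpace ℂ E] :
    E →L[ℂ] E →L[ℂ] (E →L[ℂ] E →L[ℂ] ℂ) →L[ℂ] ℂ :=
  (ContinuousLinearMap.compL ℂ (E →L[ℂ] E →L[ℂ] ℂ) (E →L[ℂ] ℂ) ℂ).flip.bilinearComp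
    (ContinuousLinearMap.apply ℂ (E →L[ℂ] ℂ)) (ContinuousLinearMap.apply ℂ ℂ)

variable {E : Type u} [NormedAddCommGroup E] [NormedSpace ℂ E]

@[simp] theorem bilinEval_apply (a b : E) (Φ : E →L[ℂ] E →L[ℂ] ℂ) :
    bilinEval E a b Φ = Φ a b := rfl

theorem norm_bilinEval (a b : E) : ‖bilinEval E a b‖ = ‖a‖ * ‖b‖ := by
  apply le_antisymm
  · refine ContinuousLinearMap.opNorm_le_bound _ (by positivity) fun Φ => ?_
    rw [bilinEval_apply]
    calc ‖Φ a b‖ ≤ ‖Φ‖ * ‖a‖ * ‖b‖ := Φ.le_opNorm₂ a b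
      _ = ‖a‖ * ‖b‖ * ‖Φ‖ := by ring
  · obtain ⟨f, hf, hfa⟩ := exists_dual_vector'' ℂ a
    obtain ⟨g, hg, hgb⟩ := exists_dual_vector'' ℂ b
    have hn : ‖f.smulRight g‖ ≤ 1 := by
      rw [ContinuousLinearMap.norm_smulRight_apply]
      exact mul_le_one₀ hf (norm_nonneg _) hg
    have h := (bilinEval E a b).le_of_opNorm_le le_rfl (f.smulRight g)
    have hv : ‖bilinEval E a b (f.smulRight g)‖ = ‖a‖ * ‖b‖ := by
      simp [hfa, hgb]
    rw [hv] at h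
    exact h.trans (mul_le_of_le_one_right (norm_nonneg _) hn)

/-- Every bounded bilinear map into `Y` extends along `bilinEval` to the dual of the space of
bounded bilinear forms, with values in the bidual of `Y`. -/
theorem exists_bilinEval_lift {Y : Type u} [NormedAddCommGroup Y] [NormedSpace ℂ Y]
    (f : E →L[ℂ] E →L[ℂ] Y) :
    ∃ G : ((E →L[ℂ] E →L[ℂ] ℂ) →L[ℂ] ℂ) →L[ℂ] StrongDual ℂ (StrongDual ℂ Y),
      (∀ u, ‖G u‖ ≤ ‖f‖ * ‖u‖) ∧
      ∀ a b, G (bilinEval E a b) = NormedSpace.inclusionInDoubleDualLi ℂ (f a b) := by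
  let K : (Y →L[ℂ] ℂ) →L[ℂ] (E →L[ℂ] E →L[ℂ] ℂ) :=
    ((ContinuousLinearMap.compL ℂ E (E →L[ℂ] Y) (E →L[ℂ] ℂ)).flip f) ∘L
      (ContinuousLinearMap.compL ℂ E Y ℂ)
  have hK : ‖K‖ ≤ ‖f‖ := by
    refine ContinuousLinearMap.opNorm_le_bound _ (norm_nonneg _) fun y => ?_
    refine ContinuousLinearMap.opNorm_le_bound₂ _ (by positivity) fun a b => ?_
    calc ‖y (f a b)‖ ≤ ‖y‖ * (‖f‖ * ‖a‖ * ‖b‖) :=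
          y.le_opNorm_of_le (f.le_opNorm₂ a b)
      _ = ‖f‖ * ‖y‖ * ‖a‖ * ‖b‖ := by ring
  refine ⟨(ContinuousLinearMap.compL ℂ (Y →L[ℂ] ℂ) (E →L[ℂ] E →L[ℂ] ℂ) ℂ).flip K,
    fun u => ?_, fun a b => rfl⟩
  calc ‖u ∘L K‖ ≤ ‖u‖ * ‖K‖ := u.opNorm_comp_le K
    _ ≤ ‖u‖ * ‖f‖ := by gcongr
    _ = ‖f‖ * ‖u‖ := mul_comm _ _

end BilinearEvaluation

section ClosedSpan

variable {E W : Type u} [NormedAddCommGroup E] [NormedSpace ℂ E]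
  [NormedAddCommGroup W] [NormedSpace ℂ W]

/-- The closed linear span of the values of a bounded bilinear map. -/
noncomputable def bilinSpan (ev : E →L[ℂ] E →L[ℂ] W) : Submodule ℂ W :=
  (Submodule.span ℂ (Set.range fun p : E × E => ev p.1 p.2)).topologicalClosure

theorem mem_bilinSpan (ev : E →L[ℂ] E →L[ℂ] W) (a b : E) : ev a b ∈ bilinSpan ev :=
  Submodule.le_topologicalClosure _ (Submodule.subset_span ⟨(a, b), rfl⟩)

instance [CompleteSpace W] (ev : E →L[ℂ] E →L[ℂ] W) : CompleteSpace (bilinSpan ev) :=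
  (Submodule.isClosed_topologicalClosure _).completeSpace_coe

/-- A bounded bilinear map, corestricted to the closed span of its values. -/
noncomputable def bilinSpanTmul (ev : E →L[ℂ] E →L[ℂ] W) : E →L[ℂ] E →L[ℂ] bilinSpan ev :=
  LinearMap.mkContinuous₂
    (LinearMap.mk₂ ℂ (fun a b => (⟨ev a b, mem_bilinSpan ev a b⟩ : bilinSpan ev))
      (fun _ _ _ => by ext; simp) (fun _ _ _ => by ext; simp)
      (fun _ _ _ => by ext; simp) (fun _ _ _ => by ext; simp))
    ‖ev‖ (fun a b => ev.le_opNorm₂ a b)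

theorem dense_span_bilinSpanTmul (ev : E →L[ℂ] E →L[ℂ] W) :
    Dense (Submodule.span ℂ (Set.range fun p : E × E => bilinSpanTmul ev p.1 p.2) :
      Set (bilinSpan ev)) := by
  rw [Subtype.dense_iff]
  have h : ((↑) '' (Submodule.span ℂ (Set.range fun p : E × E => bilinSpanTmul ev p.1 p.2) :
      Set (bilinSpan ev)) : Set W) =
      Submodule.span ℂ (Set.range fun p : E × E => ev p.1 p.2) := by
    have := Submodule.map_span (bilinSpan ev).subtype
      (Set.range fun p : E × E => bilinSpanTmul ev p.1 p.2)
    rw [← Set.range_comp] at this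
    exact congrArg SetLike.coe this
  exact h ▸ subset_rfl

set_option maxSynthPendingDepth 4 in
/-- A bounded linear map into a space containing `Y` isometrically, with values in `Y` on the
values of `ev`, maps the closed span of the values of `ev` into `Y`. -/
theorem exists_bilinSpan_lift {ev : E →L[ℂ] E →L[ℂ] W} {Y Z : Type u}
    [NormedAddCommGroup Y] [NormedSpace ℂ Y] [CompleteSpace Y]
    [NormedAddCommGroup Z] [NormedSpace ℂ Z] (J : Y →ₗᵢ[ℂ] Z)
    (f : E →L[ℂ] E →L[ℂ] Y) (G : W →L[ℂ] Z) (hG : ∀ u, ‖G u‖ ≤ ‖f‖ * ‖u‖)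
    (hGJ : ∀ a b, G (ev a b) = J (f a b)) :
    ∃ g : bilinSpan ev →L[ℂ] Y, ‖g‖ ≤ ‖f‖ ∧ ∀ a b : E, g (bilinSpanTmul ev a b) = f a b := by
  have hJ : IsClosed (LinearMap.range J.toLinearMap : Set Z) := by
    change IsClosed (Set.range J)
    exact J.isometry.isClosedEmbedding.isClosed_range
  have hmem : ∀ u : bilinSpan ev, G u ∈ LinearMap.range J.toLinearMap := by
    have hle : bilinSpan ev ≤ (LinearMap.range J.toLinearMap).comap G.toLinearMap := by
      refine Submodule.topologicalClosure_minimal _ ?_ (hJ.preimage G.continuous)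
      rw [Submodule.span_le]
      rintro _ ⟨p, rfl⟩
      exact ⟨f p.1 p.2, (hGJ _ _).symm⟩
    exact fun u => hle u.2
  let g : bilinSpan ev →L[ℂ] Y :=
    (J.equivRange.symm.toContinuousLinearEquiv : _ →L[ℂ] Y) ∘L
      ((G ∘L (bilinSpan ev).subtypeL).codRestrict _ hmem)
  have hg : ∀ u, J (g u) = G u := fun u =>
    congrArg Subtype.val (J.equivRange.apply_symm_apply ⟨G u, hmem u⟩)
  refine ⟨g, ?_, fun a b => J.injective ?_⟩
  · refine ContinuousLinearMap.opNorm_le_bound _ (norm_nonneg f) fun u => ?_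
    rw [← J.norm_map, hg]
    exact hG u
  · rw [hg]
    exact hGJ a b

end ClosedSpan

section Existence

/-- A realization of the projective tensor square of a normed space. -/
structure ProjTensorSpace (E X : Type u) [NormedAddCommGroup E] [NormedSpace ℂ E]
    [NormedAddCommGroup X] [NormedSpace ℂ X] : Type (u + 1) where
  /-- the canonical bilinear map -/
  tmul : E →L[ℂ] E →L[ℂ] X
  norm_tmul : ∀ a b : E, ‖tmul a b‖ = ‖a‖ * ‖b‖
  dense_span : Dense (Submodule.span ℂ (Set.range fun p : E × E => tmul p.1 p.2) : Set X)
  universal : ∀ (Y : Type u) [NormedAddCommGroup Y] [NormedSpace ℂ Y] [CompleteSpace Y]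
      (f : E →L[ℂ] E →L[ℂ] Y), ∃ g : X →L[ℂ] Y, ‖g‖ ≤ ‖f‖ ∧ ∀ a b : E, g (tmul a b) = f a b

set_option maxSynthPendingDepth 4 in
theorem exists_projTensorSpace_of_bidual_lift {E W : Type u} [NormedAddCommGroup E]
    [NormedSpace ℂ E] [NormedAddCommGroup W] [NormedSpace ℂ W] [CompleteSpace W]
    (ev : E →L[ℂ] E →L[ℂ] W) (hev : ∀ a b, ‖ev a b‖ = ‖a‖ * ‖b‖)
    (hlift : ∀ (Y : Type u) [NormedAddCommGroup Y] [NormedSpace ℂ Y] (f : E →L[ℂ] E →L[ℂ] Y),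
      ∃ G : W →L[ℂ] StrongDual ℂ (StrongDual ℂ Y), (∀ u, ‖G u‖ ≤ ‖f‖ * ‖u‖) ∧
        ∀ a b, G (ev a b) = NormedSpace.inclusionInDoubleDualLi ℂ (f a b)) :
    ∃ (X : Type u) (_ : NormedAddCommGroup X) (_ : NormedSpace ℂ X) (_ : CompleteSpace X),
      Nonempty (ProjTensorSpace E X) :=
  ⟨bilinSpan ev, inferInstance, inferInstance, inferInstance, ⟨{
    tmul := bilinSpanTmul ev
    norm_tmul := hev
    dense_span := dense_span_bilinSpanTmul _
    universal := fun Y _ _ _ f => by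
      obtain ⟨G, hG, hGJ⟩ := hlift Y f
      exact exists_bilinSpan_lift _ f G hG hGJ }⟩⟩

set_option maxSynthPendingDepth 4 in
theorem exists_projTensorSpace (E : Type u) [NormedAddCommGroup E] [NormedSpace ℂ E] :
    ∃ (X : Type u) (_ : NormedAddCommGroup X) (_ : NormedSpace ℂ X) (_ : CompleteSpace X),
      Nonempty (ProjTensorSpace E X) :=
  exists_projTensorSpace_of_bidual_lift (bilinEval E) norm_bilinEval
    fun _ _ _ f => exists_bilinEval_lift f

variable {E X : Type u} [NormedAddCommGroup E] [NormedSpace ℂ E]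
  [NormedAddCommGroup X] [NormedSpace ℂ X]

theorem ProjTensorSpace.hom_ext (P : ProjTensorSpace E X) {Y : Type*} [NormedAddCommGroup Y]
    [NormedSpace ℂ Y] {f g : X →L[ℂ] Y}
    (h : ∀ a b, f (P.tmul a b) = g (P.tmul a b)) : f = g :=
  ContinuousLinearMap.ext_on P.dense_span (by rintro _ ⟨p, rfl⟩; exact h _ _)

set_option maxSynthPendingDepth 4 in
/-- A bounded family of bilinear maps lifts to a bounded family of linear maps. -/
theorem ProjTensorSpace.exists_lift_family [CompleteSpace X] (P : ProjTensorSpace E X)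
    (f : E →L[ℂ] E →L[ℂ] E →L[ℂ] X) :
    ∃ g : E →L[ℂ] X →L[ℂ] X, ∀ a b c, g a (P.tmul b c) = f a b c := by
  choose g hg hgf using fun a => P.universal X (f a)
  refine ⟨LinearMap.mkContinuous
    { toFun := g
      map_add' := fun a a' => P.hom_ext fun b c => by simp [hgf]
      map_smul' := fun r a => P.hom_ext fun b c => by simp [hgf] }
    ‖f‖ fun a => (hg a).trans (f.le_opNorm a), fun a b c => hgf a b c⟩

/-- Every Banach algebra admits a realization of its projective tensor square. -/
theorem exists_projTensorSq (C : Type u) [NonUnitalNormedRing C] [NormedSpace ℂ C]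
    [IsScalarTower ℂ C C] [SMulCommClass ℂ C C] [CompleteSpace C] :
    ∃ (X : Type u) (_ : NormedAddCommGroup X) (_ : NormedSpace ℂ X) (_ : CompleteSpace X),
      Nonempty (ProjTensorSq C X) := by
  obtain ⟨X, _, _, _, ⟨P⟩⟩ := exists_projTensorSpace C
  obtain ⟨l, hl⟩ := P.exists_lift_family
    ((ContinuousLinearMap.compL ℂ C C (C →L[ℂ] X) P.tmul) ∘L ContinuousLinearMap.mul ℂ C)
  obtain ⟨r, hr⟩ := P.exists_lift_family
    (((ContinuousLinearMap.compL ℂ C C X) ∘L P.tmul).flip ∘L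
      (ContinuousLinearMap.mul ℂ C).flip)
  obtain ⟨p, -, hp⟩ := P.universal C (ContinuousLinearMap.mul ℂ C)
  exact ⟨X, _, _, ‹_›, ⟨{
    tmul := P.tmul
    norm_tmul := P.norm_tmul
    dense_span := P.dense_span
    universal := P.universal
    lsmul := l
    lsmul_tmul := hl
    rsmul := r
    rsmul_tmul := hr
    projL := p
    projL_tmul := hp }⟩⟩

end Existence

section Homomorphism

variable {A C : Type u} [NonUnitalNormedRing A] [NormedSpace ℂ A]
  [IsScalarTower ℂ A A] [SMulCommClass ℂ A A]
  [NonUnitalNormedRing C] [NormedSpace ℂ C]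
  [IsScalarTower ℂ C C] [SMulCommClass ℂ C C]
  {X Y : Type u} [NormedAddCommGroup X] [NormedSpace ℂ X] [CompleteSpace X]
  [NormedAddCommGroup Y] [NormedSpace ℂ Y] [CompleteSpace Y]

theorem ProjTensorSq.hom_ext (Q : ProjTensorSq C Y) {Z : Type*} [NormedAddCommGroup Z]
    [NormedSpace ℂ Z] {f g : Y →L[ℂ] Z}
    (h : ∀ a b, f (Q.tmul a b) = g (Q.tmul a b)) : f = g :=
  ContinuousLinearMap.ext_on Q.dense_span (by rintro _ ⟨p, rfl⟩; exact h _ _)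

/-- A bounded homomorphism induces a map of projective tensor squares that is compatible
with the left actions and the product maps. -/
theorem ProjTensorSq.exists_map (Q : ProjTensorSq C Y) (P : ProjTensorSq A X)
    (R : C →L[ℂ] A) (hR : ∀ c d, R (c * d) = R c * R d) :
    ∃ S : Y →L[ℂ] X, (∀ c u, S (Q.lsmul c u) = P.lsmul (R c) (S u)) ∧
      ∀ u, P.projL (S u) = R (Q.projL u) := by
  obtain ⟨S, -, hS⟩ := Q.universal X (P.tmul.bilinearComp R R)
  simp only [ContinuousLinearMap.bilinearComp_apply] at hS
  refine ⟨S, fun c => ?_, ?_⟩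
  · have : S ∘L Q.lsmul c = P.lsmul (R c) ∘L S := Q.hom_ext fun a b => by
      simp [Q.lsmul_tmul, P.lsmul_tmul, hS, hR]
    exact fun u => congrArg (fun f => f u) this
  · have : P.projL ∘L S = R ∘L Q.projL := Q.hom_ext fun a b => by
      simp [Q.projL_tmul, P.projL_tmul, hS, hR]
    exact fun u => congrArg (fun f => f u) this

/-- Approximate left biprojectivity passes to retracts: if a bounded homomorphism
`R : C → A` carrying `φ` to `χ` has a bounded multiplicative right inverse, then it passes
from `C` to `A`. -/
theorem ApproxLeftBiprojective.of_retract [CompleteSpace C]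
    {φ : WeakDual.characterSpace ℂ A} {χ : WeakDual.characterSpace ℂ C}
    (hC : ApproxLeftBiprojective χ) (R : C →L[ℂ] A) (hR : ∀ c d, R (c * d) = R c * R d)
    (i : A →L[ℂ] C) (hi : ∀ a b, i (a * b) = i a * i b) (hRi : ∀ a, R (i a) = a)
    (hφ : ∀ c, φ (R c) = χ c) : ApproxLeftBiprojective φ := by
  intro X _ _ _ P
  obtain ⟨_, _, _, _, ⟨Q⟩⟩ := exists_projTensorSq C
  obtain ⟨S, hSl, hSp⟩ := Q.exists_map P R hR
  obtain ⟨D, ρ, h₁, h₂, h₃⟩ := hC _ Q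
  refine ⟨D, fun α => S ∘L ρ α ∘L i, fun a x => ?_, fun a x => ?_, fun x => ?_⟩
  · have h := (S.continuous.tendsto 0).comp (h₁ (i a) (i x))
    rw [map_zero] at h
    refine h.congr fun α => ?_
    simp [hSl, hRi, hi]
  · have h := (S.continuous.tendsto 0).comp (h₂ (i a) (i x))
    rw [map_zero] at h
    refine h.congr fun α => ?_
    simp [hi, ← hφ, hRi]
  · have h := h₃ (i x)
    rw [← hφ, hRi] at h
    refine h.congr fun α => ?_
    simp [hSp, hφ]

end Homomorphism

section ProjTensorAlg

variable {A B C : Type u} [NonUnitalNormedRing A] [NormedSpace ℂ A]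
  [IsScalarTower ℂ A A] [SMulCommClass ℂ A A] [CompleteSpace A]
  [NonUnitalNormedRing B] [NormedSpace ℂ B]
  [IsScalarTower ℂ B B] [SMulCommClass ℂ B B]
  [NonUnitalNormedRing C] [NormedSpace ℂ C]
  [IsScalarTower ℂ C C] [SMulCommClass ℂ C C] [CompleteSpace C]

theorem ProjTensorAlg.hom_ext (T : ProjTensorAlg A B C) {Z : Type*} [NormedAddCommGroup Z]
    [NormedSpace ℂ Z] {f g : C →L[ℂ] Z}
    (h : ∀ a b, f (T.tmul a b) = g (T.tmul a b)) : f = g :=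
  ContinuousLinearMap.ext_on T.dense_span (by rintro _ ⟨p, rfl⟩; exact h _ _)

/-- The slice homomorphism `id ⊗ ψ` attached to a character `ψ` of the right factor. -/
theorem ProjTensorAlg.exists_slice (T : ProjTensorAlg A B C)
    (ψ : WeakDual.characterSpace ℂ B) :
    ∃ R : C →L[ℂ] A, (∀ a b, R (T.tmul a b) = ψ b • a) ∧
      ∀ c d, R (c * d) = R c * R d := by
  let ψ' : B →L[ℂ] ℂ := WeakDual.CharacterSpace.toCLM ψ
  have hψ' : ∀ b, ψ' b = ψ b := fun _ => rfl
  obtain ⟨R, -, hR⟩ := T.universal A ((ContinuousLinearMap.smulRightL ℂ B A) ψ')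
  have hR' : ∀ a b, R (T.tmul a b) = ψ b • a := fun a b => by
    rw [hR]; rfl
  refine ⟨R, hR', ?_⟩
  have h : (ContinuousLinearMap.compL ℂ C C A R) ∘L ContinuousLinearMap.mul ℂ C =
      (ContinuousLinearMap.mul ℂ A).bilinearComp R R :=
    T.hom_ext fun a b => T.hom_ext fun c d => by
      simp [T.tmul_mul, hR', smul_smul, mul_comm]
  exact fun c d => congrArg (fun f => f c d) h

end ProjTensorAlg

/-- Theorem 2.9.  Let `A` and `B` be Banach algebras, `φ ∈ Δ(A)` and
`ψ ∈ Δ(B)`.  Suppose `A` is unital and `B` has an idempotent `x₀` with `ψ(x₀) = 1`.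
If the projective tensor product `A ⊗̂ B` (realized as the Banach algebra `C`) is
approximately left `(φ ⊗ ψ)`-biprojective, then `A` is approximately left
`φ`-biprojective. -/
theorem projTensor_approxLeftBiprojective_implies_left_factor
    {A B C : Type u} [NonUnitalNormedRing A] [NormedSpace ℂ A]
    [IsScalarTower ℂ A A] [SMulCommClass ℂ A A] [CompleteSpace A]
    [NonUnitalNormedRing B] [NormedSpace ℂ B]
    [IsScalarTower ℂ B B] [SMulCommClass ℂ B B] [CompleteSpace B]
    [NonUnitalNormedRing C] [NormedSpace ℂ C]
    [IsScalarTower ℂ C C] [SMulCommClass ℂ C C] [CompleteSpace C]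
    (T : ProjTensorAlg A B C)
    (φ : WeakDual.characterSpace ℂ A) (ψ : WeakDual.characterSpace ℂ B)
    (e : A) (he : ∀ a : A, e * a = a ∧ a * e = a)
    (x₀ : B) (hx₀ : x₀ * x₀ = x₀) (hψx₀ : ψ x₀ = 1)
    (χ : WeakDual.characterSpace ℂ C)
    (hχ : ∀ (a : A) (b : B), χ (T.tmul a b) = φ a * ψ b)
    (hC : ApproxLeftBiprojective χ) :
    ApproxLeftBiprojective φ := by
  obtain ⟨R, hR, hRm⟩ := T.exists_slice ψ
  refine hC.of_retract R hRm (T.tmul.flip x₀) (fun a b => ?_) (fun a => ?_) ?_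
  · simp [T.tmul_mul, hx₀]
  · simp [hR, hψx₀]
  · have h : (WeakDual.CharacterSpace.toCLM φ : A →L[ℂ] ℂ) ∘L R =
        WeakDual.CharacterSpace.toCLM χ := T.hom_ext fun a b => by
      simp [hR, hχ, mul_comm]
    exact fun c => congrArg (fun f => f c) h
end
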